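/- Unusual crossing relation of the SU(N) S-matrix: for every θ ∈ ℂ for which all amplitude values occurring are defined, and for all indices α1,…,α_{N−1}, β, δ, δ' ∈ {1,…,N}: Σ_{β1,…,β_{N−1}} Σ_{δ1,…,δ_{N−2}} ε_{β1 β2 … β_{N−1} β} · S^{δ'β1}_{α1δ1}(θ + iπ − iη) · S^{δ1β2}_{α2δ2}(θ + iπ − 2iη) ⋯ S^{δ_{N−2}β_{N−1}}_{α_{N−1}δ}(θ + iπ − (N−1)iη) = (−1)^{N−1} · Σ_{γ=1}^{N} ε_{α1 α2 … α_{N−1} γ} · S^{γδ'}_{δβ}(iπ − θ), where all summation indices run over {1,…,N} and ε is the totally antisymmetric Levi-Civita symbol on N indices with ε_{1,2,…,N} = 1. -/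

import Mathlib

open Complex

noncomputable section

/-- η = 2π/N, as a complex number. -/
def etaC (N : ℕ) : ℂ := 2 * (Real.pi : ℂ) / N

/-- 2πi. -/
def twoPiI : ℂ := 2 * (Real.pi : ℂ) * Complex.I

/-- `z` is not a pole of the Gamma function. -/
def GammaDefined (z : ℂ) : Prop := ∀ m : ℕ, z ≠ -(m : ℂ)

/-- The highest weight S-matrix amplitude a(θ). -/
def aAmp (N : ℕ) (θ : ℂ) : ℂ :=
  -(Complex.Gamma (1 - θ / twoPiI) * Complex.Gamma (1 - 1 / N + θ / twoPiI)) /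
    (Complex.Gamma (1 + θ / twoPiI) * Complex.Gamma (1 - 1 / N - θ / twoPiI))

/-- The amplitude b(θ) = a(θ)·θ/(θ − iη). -/
def bAmp (N : ℕ) (θ : ℂ) : ℂ := aAmp N θ * θ / (θ - Complex.I * etaC N)

/-- The amplitude c(θ) = −iη·a(θ)/(θ − iη). -/
def cAmp (N : ℕ) (θ : ℂ) : ℂ := -(Complex.I * etaC N) * aAmp N θ / (θ - Complex.I * etaC N)

/-- All Gamma factors in a(θ) are defined and the denominator Gammas are nonzero. -/
def aDefined (N : ℕ) (θ : ℂ) : Prop :=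
  GammaDefined (1 - θ / twoPiI) ∧ GammaDefined (1 - 1 / N + θ / twoPiI) ∧
    GammaDefined (1 + θ / twoPiI) ∧ GammaDefined (1 - 1 / N - θ / twoPiI) ∧
    Complex.Gamma (1 + θ / twoPiI) ≠ 0 ∧ Complex.Gamma (1 - 1 / N - θ / twoPiI) ≠ 0

/-- The amplitudes b(θ) and c(θ) are defined: a(θ) is defined and θ − iη ≠ 0. -/
def bDefined (N : ℕ) (θ : ℂ) : Prop := aDefined N θ ∧ θ ≠ Complex.I * etaC N

/-- The S-matrix entries S^{δγ}_{αβ}(θ) = δ_{αγ}δ_{βδ}·b(θ) + δ_{αδ}δ_{βγ}·c(θ). -/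
def SEntry (N : ℕ) (θ : ℂ) (δ γ α β : Fin N) : ℂ :=
  (if α = γ then 1 else 0) * (if β = δ then 1 else 0) * bAmp N θ +
    (if α = δ then 1 else 0) * (if β = γ then 1 else 0) * cAmp N θ

open Classical in
/-- The totally antisymmetric Levi-Civita symbol: the sign of `f` if `f` is a
permutation, and `0` otherwise (i.e. if two indices coincide). -/
def levi {n : ℕ} (f : Fin n → Fin n) : ℤ :=
  if h : Function.Bijective f then ((Equiv.Perm.sign (Equiv.ofBijective f h) : ℤˣ) : ℤ) else 0

/-- The N-tuple (b₁, …, b_{N−1}, β). -/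
def snocTuple (N : ℕ) (b : Fin (N - 1) → Fin N) (β : Fin N) : Fin N → Fin N :=
  fun i => if h : (i : ℕ) < N - 1 then b ⟨i, h⟩ else β

/-- The chain of internal indices δ₀ = δ', δ₁, …, δ_{N−2}, δ_{N−1} = δ. -/
def chainIdx (N : ℕ) (δ' δ : Fin N) (d : Fin (N - 2) → Fin N) (k : ℕ) : Fin N :=
  if hk : k = 0 then δ' else if h : k ≤ N - 2 then d ⟨k - 1, by omega⟩ else δ

open Finset Equiv

/-- The Levi-Civita symbol is the determinant of the matrix with rows `e_{f i}`. -/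
theorem levi_eq_det {n : ℕ} (f : Fin n → Fin n) :
    ((levi f : ℤ) : ℂ) = ((1 : Matrix (Fin n) (Fin n) ℂ).submatrix f id).det := by
  unfold levi
  split_ifs with h
  · have := Matrix.det_permute (Equiv.ofBijective f h) (1 : Matrix (Fin n) (Fin n) ℂ)
    rw [Matrix.det_one, mul_one] at this
    exact this.symm
  · have hinj : ¬ Function.Injective f := fun hf => h (Finite.injective_iff_bijective.mp hf)
    simp only [Function.Injective, not_forall] at hinj
    obtain ⟨i, j, hij, hne⟩ := hinj
    rw [Matrix.det_zero_of_row_eq hne (by ext c; rw [Matrix.submatrix_apply, hij, Matrix.submatrix_apply])]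
    simp

theorem levi_comp_swap {n : ℕ} (f : Fin n → Fin n) {i j : Fin n} (hij : i ≠ j) :
    ((levi (f ∘ swap i j) : ℤ) : ℂ) = -((levi f : ℤ) : ℂ) := by
  rw [levi_eq_det, levi_eq_det]
  have := Matrix.det_permute (swap i j) ((1 : Matrix (Fin n) (Fin n) ℂ).submatrix f id)
  rw [Equiv.Perm.sign_swap hij] at this
  simpa using this

/-- Antisymmetrising over `n + 1` indices with `n` values gives zero. -/
theorem sum_levi_update {n : ℕ} (f : Fin n → Fin n) (p q : Fin n) :
    ∑ j, (if f j = p then (1 : ℂ) else 0) * ((levi (Function.update f j q) : ℤ) : ℂ) =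
      (if q = p then 1 else 0) * ((levi f : ℤ) : ℂ) := by
  set M := (1 : Matrix (Fin n) (Fin n) ℂ).submatrix f id with hM
  have hrow (j : Fin n) : ((levi (Function.update f j q) : ℤ) : ℂ) = M.adjugate q j := by
    rw [levi_eq_det, Matrix.adjugate_apply]
    congr 1
    ext i c
    by_cases hi : i = j
    · subst hi
      simp [Matrix.one_apply, Pi.single_apply, eq_comm]
    · rw [Matrix.updateRow_ne hi, hM, Matrix.submatrix_apply, Matrix.submatrix_apply,
        Function.update_of_ne hi]
  have h := congrFun (congrFun (Matrix.adjugate_mul M) q) p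
  rw [Matrix.mul_apply] at h
  simp only [hrow, levi_eq_det f]
  rw [← hM]
  simpa [hM, Matrix.one_apply, mul_comm] using h

/-- The chain `p, d₀, …, d_{m-1}, q`. -/
def chain {ι : Type*} {m : ℕ} (p q : ι) (d : Fin m → ι) (k : ℕ) : ι :=
  if hk : k = 0 then p else if h : k ≤ m then d ⟨k - 1, by omega⟩ else q

theorem chain_zero {ι : Type*} {m : ℕ} (p q : ι) (d : Fin m → ι) : chain p q d 0 = p := rfl

theorem chain_cons_succ {ι : Type*} {m : ℕ} (p q r : ι) (d : Fin m → ι) (k : ℕ) :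
    chain p q (Fin.cons r d : Fin (m + 1) → ι) (k + 1) = chain r q d k := by
  rcases k with _ | k
  · simp [chain]
  · by_cases h : k + 1 ≤ m
    · have : (⟨k + 1, by omega⟩ : Fin (m + 1)) = Fin.succ ⟨k, h⟩ := rfl
      simp [chain, h, this, -Fin.succ_mk]
    · simp [chain, h]

theorem chain_one_of_zero {ι : Type*} (p q : ι) (d : Fin 0 → ι) : chain p q d 1 = q := by
  simp [chain]

theorem sum_fin_cons {ι : Type*} [Fintype ι] {m : ℕ} (F : (Fin (m + 1) → ι) → ℂ) :
    ∑ b, F b = ∑ r, ∑ b : Fin m → ι, F (Fin.cons r b) := by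
  rw [← (Fin.consEquiv fun _ : Fin (m + 1) => ι).sum_comp, Fintype.sum_prod_type]
  rfl

/-- Contracting a row of `m + 1` rational R-matrices, with spectral parameters in arithmetic
progression, with an antisymmetric tensor. -/
theorem fusion {ι : Type*} [Fintype ι] [DecidableEq ι] (h : ℂ) (m : ℕ) (w : ℂ)
    (L : (Fin (m + 1) → ι) → ℂ)
    (hL : ∀ i j, i ≠ j → ∀ f, L (f ∘ swap i j) = -L f) (α : Fin (m + 1) → ι) (p q : ι) :
    ∑ b, ∑ d : Fin m → ι, L b * ∏ k : Fin (m + 1),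
        ((if α k = b k then 1 else 0) * (if chain p q d (k + 1) = chain p q d k then 1 else 0) *
            (w - (k : ℕ) * h) +
          (if α k = chain p q d k then 1 else 0) * (if chain p q d (k + 1) = b k then 1 else 0) *
            (-h)) =
      (∏ k ∈ range m, (w - k * h)) * ((w - m * h) * ((if q = p then 1 else 0) * L α) -
        h * ∑ j, (if α j = p then 1 else 0) * L (Function.update α j q)) := by
  induction m generalizing w p with
  | zero =>
    have hu (b : Fin (0 + 1) → ι) : Function.update b 0 q = fun _ => q := by
      ext i; rw [Fin.fin_one_eq_zero i]; simp
    have hα : (fun _ => α 0) = α := by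
      ext i; rw [Fin.fin_one_eq_zero i]
    have hc (r : ι) (b : Fin 0 → ι) : (Fin.cons r b : Fin (0 + 1) → ι) = fun _ => r := by
      ext i; rw [Fin.fin_one_eq_zero i]; rfl
    rw [sum_fin_cons]
    simp [chain_zero, chain_one_of_zero, hu, hc, mul_add, sum_add_distrib]
    rw [hα]
    split_ifs <;> ring
  | succ m ih =>
    have hLcons (r : ι) (i j : Fin (m + 1)) (hij : i ≠ j) (f : Fin (m + 1) → ι) :
        L (Fin.cons r (f ∘ swap i j)) = -L (Fin.cons r f) := by
      rw [← hL i.succ j.succ (by simpa using hij)]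
      congr 1
      ext k
      refine Fin.cases ?_ (fun k => ?_) k
      · simp [swap_apply_of_ne_of_ne (Fin.succ_ne_zero i).symm (Fin.succ_ne_zero j).symm]
      · have : swap i.succ j.succ k.succ = (swap i j k).succ := by
          simp only [swap_apply_def, Fin.succ_inj]
          split_ifs <;> rfl
        simp [this]
    have hprod : ∏ k ∈ range (m + 1), (w - k * h) = w * ∏ k ∈ range m, (w - h - k * h) := by
      rw [prod_range_succ', mul_comm]
      congr 1
      · simp
      · exact prod_congr rfl fun k _ => by push_cast; ring
    have hG (r s : ι) := ih (w - h) (fun b => L (Fin.cons r b)) (hLcons r) (fun k => α k.succ) s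
    have hdiag (j : Fin (m + 1)) :
        L (Fin.cons (α j.succ) (Function.update (fun k => α k.succ) j q)) =
          -L (Fin.cons q fun k => α k.succ) := by
      rw [← hL 0 j.succ (Fin.succ_ne_zero j).symm]
      congr 1
      ext k
      refine Fin.cases ?_ (fun k => ?_) k
      · simp
      · by_cases hk : k = j
        · subst hk
          simp
        · rw [Function.comp_apply, swap_apply_of_ne_of_ne (Fin.succ_ne_zero k) (by simpa using hk)]
          simp [hk]
    have hα : (Fin.cons (α 0) fun k => α k.succ : Fin (m + 2) → ι) = α := Fin.cons_self_tail α
    have hu0 : Function.update α 0 q = (Fin.cons q fun k => α k.succ : Fin (m + 2) → ι) := by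
      conv_lhs => rw [← hα]
      exact Fin.update_cons_zero _ _ _
    have hus (j : Fin (m + 1)) : Function.update α j.succ q =
        (Fin.cons (α 0) (Function.update (fun k => α k.succ) j q) : Fin (m + 2) → ι) := by
      conv_lhs => rw [← hα]
      exact (Fin.cons_update _ _ _ _).symm
    have hshift (k : ℕ) : w - ((k + 1 : ℕ) : ℂ) * h = w - h - k * h := by
      push_cast; ring
    set G : ι → ι → ℂ := fun r s => ∑ b : Fin (m + 1) → ι, ∑ d : Fin m → ι,
      L (Fin.cons r b) * ∏ k : Fin (m + 1),
        ((if α k.succ = b k then 1 else 0) *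
            (if chain s q d (k + 1) = chain s q d k then 1 else 0) * (w - h - (k : ℕ) * h) +
          (if α k.succ = chain s q d k then 1 else 0) *
            (if chain s q d (k + 1) = b k then 1 else 0) * (-h)) with hGdef
    have hsplit : ∀ r, (∑ b : Fin (m + 1) → ι, ∑ d : Fin (m + 1) → ι,
        L (Fin.cons r b) * ∏ k : Fin (m + 2),
        ((if α k = (Fin.cons r b : Fin (m + 2) → ι) k then 1 else 0) *
            (if chain p q d (k + 1) = chain p q d k then 1 else 0) * (w - (k : ℕ) * h) +
          (if α k = chain p q d k then 1 else 0) *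
            (if chain p q d (k + 1) = (Fin.cons r b : Fin (m + 2) → ι) k then 1 else 0) *
            (-h))) =
        ∑ s, ((if α 0 = r then 1 else 0) * (if s = p then 1 else 0) * w +
          (if α 0 = p then 1 else 0) * (if s = r then 1 else 0) * (-h)) * G r s := by
      intro r
      simp only [hGdef, mul_sum]
      refine (sum_congr rfl fun b _ => ?_).trans sum_comm
      rw [sum_fin_cons]
      refine sum_congr rfl fun s _ => sum_congr rfl fun d _ => ?_
      rw [Fin.prod_univ_succ]
      simp only [hshift, Fin.cons_zero, Fin.cons_succ, Fin.val_succ, Fin.val_zero, chain_zero,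
        chain_cons_succ, Nat.cast_zero, zero_mul, sub_zero]
      exact mul_left_comm _ _ _
    rw [sum_fin_cons]
    simp only [hsplit, add_mul, sum_add_distrib]
    have hG' (r s : ι) : G r s = _ := hG r s
    have h1 : ∑ r, ∑ s, (if α 0 = r then (1 : ℂ) else 0) * (if s = p then 1 else 0) * w * G r s =
        w * G (α 0) p := by
      simp [ite_mul]
    have h2 : ∑ r, ∑ s, (if α 0 = p then (1 : ℂ) else 0) * (if s = r then 1 else 0) * (-h) *
        G r s = (if α 0 = p then 1 else 0) * (-h) * ∑ r, G r r := by
      simp [ite_mul, mul_sum]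
    have h3 : ∑ r, G r r = (∏ k ∈ range m, (w - h - k * h)) *
        (w * L (Fin.cons q fun k => α k.succ)) := by
      simp only [hG', ← mul_sum, sum_sub_distrib]
      rw [sum_comm]
      simp [hdiag, -Fin.cons_update]
      left
      ring
    rw [h1, h2, h3, hG', hprod, Fin.sum_univ_succ (n := m + 1), hα, hu0]
    simp only [hus]
    push_cast
    ring

theorem prod_range_div_telescope (f : ℕ → ℂ) (n : ℕ) (hf : ∀ k < n, f k ≠ 0) :
    (∏ k ∈ range n, f (k + 1) / f k) * f 0 = f n := by
  induction n with
  | zero => simp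
  | succ n ih =>
    rw [prod_range_succ, mul_right_comm, ih fun k hk => hf k (by omega),
      mul_div_cancel₀ _ (hf n (by omega))]

theorem twoPiI_ne_zero : twoPiI ≠ 0 := by
  simp [twoPiI, Real.pi_ne_zero]

set_option maxHeartbeats 1600000 in
/-- The amplitudes along the chain telescope to the single crossed amplitude. -/
theorem prod_amplitudes (m : ℕ) (θ : ℂ)
    (hd : ∀ k ∈ Finset.Icc 1 (m + 1), bDefined (m + 2)
      (θ + (Real.pi : ℂ) * Complex.I - (k : ℂ) * (Complex.I * etaC (m + 2))))
    (hc : bDefined (m + 2) ((Real.pi : ℂ) * Complex.I - θ)) (w : ℂ)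
    (hw : w = θ + (Real.pi : ℂ) * Complex.I - Complex.I * etaC (m + 2)) :
    (∏ k ∈ range (m + 1), aAmp (m + 2) (w - k * (Complex.I * etaC (m + 2))) /
        (w - k * (Complex.I * etaC (m + 2)) - Complex.I * etaC (m + 2))) *
      ∏ k ∈ range m, (w - k * (Complex.I * etaC (m + 2))) =
    (-1) ^ m * (aAmp (m + 2) ((Real.pi : ℂ) * Complex.I - θ) /
      ((Real.pi : ℂ) * Complex.I - θ - Complex.I * etaC (m + 2))) := by
  set h : ℂ := 1 / (m + 2 : ℂ) with hh
  have hm2 : (m + 2 : ℂ) ≠ 0 := by exact_mod_cast (by omega : m + 2 ≠ 0)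
  have hη : Complex.I * etaC (m + 2) = twoPiI * h := by
    simp only [etaC, twoPiI, hh]; push_cast; ring
  have hπ : (Real.pi : ℂ) * Complex.I = twoPiI * (1 / 2) := by
    simp only [twoPiI]; ring
  have hT := twoPiI_ne_zero
  obtain ⟨y, hy⟩ : ∃ y, (Real.pi : ℂ) * Complex.I - θ = twoPiI * y :=
    ⟨_, (mul_div_cancel₀ _ hT).symm⟩
  have hθ (k : ℂ) : θ + (Real.pi : ℂ) * Complex.I - k * (twoPiI * h) =
      twoPiI * (1 - y - k * h) := by
    linear_combination 2 * hπ - hy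
  have hwk (k : ℂ) : w - k * (twoPiI * h) = twoPiI * (1 - y - (k + 1) * h) := by
    rw [← hθ, hw, hη]; ring
  have hN : (1 : ℂ) / ((m + 2 : ℕ) : ℂ) = h := by push_cast; rfl
  have hlast : (m + 2 : ℂ) * h = 1 := by rw [hh]; field_simp
  rw [hy] at hc ⊢
  simp only [hη, hθ] at hd
  simp only [hη, hwk]
  have ha (u : ℂ) : aAmp (m + 2) (twoPiI * u) =
      -(Complex.Gamma (1 - u) * Complex.Gamma (1 - h + u)) /
        (Complex.Gamma (1 + u) * Complex.Gamma (1 - h - u)) := by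
    rw [aAmp, mul_div_cancel_left₀ _ hT, hN]
  have hdef (u : ℂ) (hu : bDefined (m + 2) (twoPiI * u)) : GammaDefined (1 - u) ∧
      GammaDefined (1 - h + u) ∧ GammaDefined (1 + u) ∧ GammaDefined (1 - h - u) ∧ u ≠ h := by
    obtain ⟨⟨h1, h2, h3, h4, -, -⟩, h5⟩ := hu
    rw [mul_div_cancel_left₀ _ hT] at h1 h2 h3 h4
    rw [hN] at h2 h4
    exact ⟨h1, h2, h3, h4, fun e => h5 (by rw [e, hη])⟩
  obtain ⟨-, -, hc1, hc2, hyh⟩ := hdef y hc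
  have hd' (k : ℕ) (hk : k < m + 1) := hdef _ (hd (k + 1) (by simp; omega))
  push_cast at hd'
  set F : ℕ → ℂ := fun k => Complex.Gamma (y + k * h) * Complex.Gamma (2 - y - (k + 1) * h)
    with hF
  have hF0 (k : ℕ) (hk : k < m + 1) : F k ≠ 0 := by
    obtain ⟨-, -, h3, h4, -⟩ := hd' k hk
    refine mul_ne_zero ?_ ?_
    · convert Complex.Gamma_ne_zero h4 using 2; ring
    · convert Complex.Gamma_ne_zero h3 using 2; ring
  have haF (k : ℕ) : aAmp (m + 2) (twoPiI * (1 - y - (k + 1) * h)) = -1 * (F (k + 1) / F k) := by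
    rw [ha, neg_div, neg_one_mul, hF]
    push_cast
    congr 2
    · congr 2 <;> ring
    · rw [mul_comm]; congr 2 <;> ring
  set v : ℕ → ℂ := fun k => 1 - y - (k + 1) * h with hv
  have hv0 : ∀ k ≤ m + 1, v k ≠ 0 := by
    rintro (_ | k) hk
    · have := hc2 0
      intro e
      apply this
      simp only [hv] at e
      push_cast at e ⊢
      linear_combination e
    · intro e
      apply (hd' k (by omega)).2.2.2.2
      simp only [hv] at e
      push_cast at e
      linear_combination e
  have hprodv (n : ℕ) (hn : n ≤ m) : (∏ k ∈ range (n + 1), 1 / (twoPiI * v (k + 1))) *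
      ∏ k ∈ range n, (twoPiI * v k) = v 0 / (twoPiI * v n * v (n + 1)) := by
    induction n with
    | zero =>
      have := hv0 0 (by omega)
      have := hv0 1 (by omega)
      simp; field_simp
    | succ n ihn =>
      have := hv0 n (by omega)
      have := hv0 (n + 1) (by omega)
      have := hv0 (n + 2) (by omega)
      rw [prod_range_succ, prod_range_succ (fun k => twoPiI * v k), mul_mul_mul_comm,
        ihn (by omega)]
      field_simp
  have hden (k : ℕ) : twoPiI * (1 - y - ((k : ℂ) + 1) * h) - twoPiI * h = twoPiI * v (k + 1) := by
    simp only [hv]; push_cast; ring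
  simp only [hden, haF]
  have hA : ∏ k ∈ range (m + 1), (-1 * (F (k + 1) / F k)) = (-1) ^ (m + 1) * (F (m + 1) / F 0) := by
    rw [prod_mul_distrib, prod_const, card_range, ← prod_range_div_telescope F (m + 1) hF0,
      mul_div_cancel_right₀ _ (hF0 0 (by omega))]
  have hsplit : (∏ k ∈ range (m + 1), -1 * (F (k + 1) / F k) / (twoPiI * v (k + 1))) =
      (∏ k ∈ range (m + 1), (-1 * (F (k + 1) / F k))) *
        ∏ k ∈ range (m + 1), 1 / (twoPiI * v (k + 1)) := by
    rw [← prod_mul_distrib]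
    exact prod_congr rfl fun k _ => by ring
  rw [hsplit, hA, mul_assoc, hprodv m le_rfl, ha]
  have hy0 : y ≠ 0 := by
    have := hv0 (m + 1) le_rfl
    intro e
    apply this
    simp only [hv]
    push_cast
    linear_combination -hlast - e
  have hvm : v m = h - y := by simp only [hv]; linear_combination -hlast
  have hvm1 : v (m + 1) = -y := by simp only [hv]; push_cast; linear_combination -hlast
  have hv00 : v 0 = 1 - h - y := by simp only [hv]; push_cast; ring
  have hFm : F (m + 1) = Complex.Gamma (1 - h + y) * Complex.Gamma (1 - y) := by
    simp only [hF]
    push_cast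
    congr 2
    · linear_combination hlast
    · linear_combination -hlast
  have hF00 : F 0 = Complex.Gamma y * (v 0 * Complex.Gamma (1 - h - y)) := by
    rw [hv00, ← Complex.Gamma_add_one _ (by rw [← hv00]; exact hv0 0 (by omega))]
    simp only [hF]
    push_cast
    congr 2 <;> ring
  have hΓ : Complex.Gamma (1 + y) = y * Complex.Gamma y := by
    rw [add_comm, Complex.Gamma_add_one _ hy0]
  have hne := hF0 0 (by omega)
  rw [hF00] at hne
  have hv0' := hv0 0 (by omega)
  have hΓy : Complex.Gamma y ≠ 0 := left_ne_zero_of_mul hne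
  have hΓh : Complex.Gamma (1 - h - y) ≠ 0 := right_ne_zero_of_mul (right_ne_zero_of_mul hne)
  have hyh' : y - h ≠ 0 := sub_ne_zero.mpr hyh
  have hyh'' : h - y ≠ 0 := sub_ne_zero.mpr hyh.symm
  rw [hF00, hFm, hΓ, hvm, hvm1, ← mul_sub, ← neg_sub y h, pow_succ]
  field_simp

theorem snocTuple_eq_snoc {m : ℕ} (b : Fin (m + 1) → Fin (m + 2)) (β : Fin (m + 2)) :
    snocTuple (m + 2) b β = (Fin.snoc b β : Fin (m + 2) → Fin (m + 2)) := by
  ext k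
  refine Fin.lastCases ?_ (fun k => ?_) k
  · simp [snocTuple]
  · simp [snocTuple, Nat.le_of_lt_succ k.isLt]

/-- Unusual crossing relation of the SU(N) S-matrix. -/
theorem unusual_crossing_SUN (N : ℕ) (hN : 2 ≤ N) (θ : ℂ)
    (hd : ∀ k ∈ Finset.Icc 1 (N - 1),
      bDefined N (θ + (Real.pi : ℂ) * Complex.I - (k : ℂ) * (Complex.I * etaC N)))
    (hc : bDefined N ((Real.pi : ℂ) * Complex.I - θ))
    (α : Fin (N - 1) → Fin N) (β δ δ' : Fin N) :
    (∑ b : Fin (N - 1) → Fin N, ∑ d : Fin (N - 2) → Fin N,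
        ((levi (snocTuple N b β) : ℤ) : ℂ) *
          ∏ k : Fin (N - 1),
            SEntry N (θ + (Real.pi : ℂ) * Complex.I - (((k : ℕ) : ℂ) + 1) * (Complex.I * etaC N))
              (chainIdx N δ' δ d k) (b k) (α k) (chainIdx N δ' δ d ((k : ℕ) + 1))) =
      (-1 : ℂ) ^ (N - 1) *
        ∑ γ : Fin N, ((levi (snocTuple N α γ) : ℤ) : ℂ) *
          SEntry N ((Real.pi : ℂ) * Complex.I - θ) γ δ' δ β := by
  obtain ⟨m, rfl⟩ : ∃ m, N = m + 2 := ⟨N - 2, by omega⟩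
  set H := Complex.I * etaC (m + 2) with hH
  set w := θ + (Real.pi : ℂ) * Complex.I - H with hw
  set φ := (Real.pi : ℂ) * Complex.I - θ with hφ
  have hS (u : ℂ) (r s a b : Fin (m + 2)) : SEntry (m + 2) u r s a b =
      aAmp (m + 2) u / (u - H) * ((if a = s then 1 else 0) * (if b = r then 1 else 0) * u +
        (if a = r then 1 else 0) * (if b = s then 1 else 0) * (-H)) := by
    simp only [SEntry, bAmp, cAmp, ← hH]; ring
  have hchain (d : Fin m → Fin (m + 2)) (k : ℕ) :
      chainIdx (m + 2) δ' δ d k = chain δ' δ d k := rfl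
  have hθ (k : ℕ) : θ + (Real.pi : ℂ) * Complex.I - ((k : ℂ) + 1) * H = w - k * H := by
    rw [hw]; ring
  have hamp := prod_amplitudes m θ hd hc w hw
  rw [← hH, ← hφ] at hamp
  have hfus := fusion H m w (fun b => ((levi (snocTuple (m + 2) b β) : ℤ) : ℂ)) ?_ α δ' δ
  · have hlast : w - (m : ℂ) * H = H - φ := by
      have : (m + 2 : ℂ) ≠ 0 := by exact_mod_cast (by omega : m + 2 ≠ 0)
      rw [hw, hφ, hH, etaC]
      push_cast
      field_simp
      ring
    have hgarnir := sum_levi_update (snocTuple (m + 2) α β) δ' δ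
    rw [Fin.sum_univ_castSucc] at hgarnir
    simp only [snocTuple_eq_snoc, ← Fin.snoc_update, Fin.update_snoc_last, Fin.snoc_castSucc,
      Fin.snoc_last] at hgarnir hfus ⊢
    have hlhs : ∀ (b : Fin (m + 1) → Fin (m + 2)) (d : Fin m → Fin (m + 2)),
        ((levi (Fin.snoc b β : Fin (m + 2) → Fin (m + 2)) : ℤ) : ℂ) * ∏ k : Fin (m + 1),
          SEntry (m + 2) (θ + (Real.pi : ℂ) * Complex.I - (((k : ℕ) : ℂ) + 1) * H)
            (chainIdx (m + 2) δ' δ d k) (b k) (α k) (chainIdx (m + 2) δ' δ d ((k : ℕ) + 1)) =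
        (∏ k ∈ range (m + 1), aAmp (m + 2) (w - k * H) / (w - k * H - H)) *
        (((levi (Fin.snoc b β : Fin (m + 2) → Fin (m + 2)) : ℤ) : ℂ) * ∏ k : Fin (m + 1),
          ((if α k = b k then 1 else 0) *
              (if chain δ' δ d (k + 1) = chain δ' δ d k then 1 else 0) * (w - (k : ℕ) * H) +
            (if α k = chain δ' δ d k then 1 else 0) *
              (if chain δ' δ d (k + 1) = b k then 1 else 0) * (-H))) := by
      intro b d
      simp only [hS, hchain, hθ, prod_mul_distrib]
      rw [Fin.prod_univ_eq_prod_range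
        (fun k => aAmp (m + 2) (w - (k : ℂ) * H) / (w - (k : ℂ) * H - H))]
      ring
    have hrhs : ∑ γ, ((levi (Fin.snoc α γ : Fin (m + 2) → Fin (m + 2)) : ℤ) : ℂ) *
        SEntry (m + 2) φ γ δ' δ β = aAmp (m + 2) φ / (φ - H) *
        (φ * ((if δ = δ' then 1 else 0) *
            ((levi (Fin.snoc α β : Fin (m + 2) → Fin (m + 2)) : ℤ) : ℂ)) -
          H * ((if β = δ' then 1 else 0) *
            ((levi (Fin.snoc α δ : Fin (m + 2) → Fin (m + 2)) : ℤ) : ℂ))) := by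
      simp only [hS, mul_add, sum_add_distrib]
      simp
      split_ifs <;> ring
    have hfac (C : ℂ) (X : (Fin (m + 1) → Fin (m + 2)) → (Fin m → Fin (m + 2)) → ℂ) :
        ∑ b, ∑ d, C * X b d = C * ∑ b, ∑ d, X b d := by
      simp only [mul_sum]
    refine (sum_congr rfl fun b _ => sum_congr rfl fun d _ => hlhs b d).trans ((hfac _ _).trans ?_)
    rw [hfus, ← mul_assoc, hamp, hlast]
    erw [hrhs]
    rw [show m + 2 - 1 = m + 1 from rfl, pow_succ]
    linear_combination (-((-1) ^ m * (aAmp (m + 2) φ / (φ - H)) * H)) * hgarnir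
  · intro i j hij f
    have := levi_comp_swap (snocTuple (m + 2) f β) (i := i.castSucc) (j := j.castSucc)
      (by simpa using hij)
    rw [← this]
    simp only [snocTuple_eq_snoc]
    congr 2
    ext k
    refine Fin.lastCases ?_ (fun k => ?_) k
    · have : swap i.castSucc j.castSucc (Fin.last (m + 1)) = Fin.last (m + 1) :=
        swap_apply_of_ne_of_ne (Fin.castSucc_lt_last i).ne' (Fin.castSucc_lt_last j).ne'
      simp [this]
    · have : swap i.castSucc j.castSucc k.castSucc = (swap i j k).castSucc := by
        simp only [swap_apply_def, Fin.castSucc_inj]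
        split_ifs <;> rfl
      simp [this]
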